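/- (Bound preservation of the stabilized IMEX fourth-order scheme for the generalized Allen-Cahn equation with homogeneous Dirichlet boundary condition.) Let β > 0, ε > 0, S ≥ 0, and let g : ℝ → ℝ (playing the role of F') be differentiable on [−β, β] with g(−β) = g(β) = 0. Set the effective time step Δt̃ = Δt/(1 + Δt·S) and c̃ = h²/(μΔt̃). Assume: h·‖(u,v)‖_∞/μ ≤ 1/3; Δt̃·μ/h² ≥ 3; and Δt̃·g'(x) ≤ ε for all x ∈ [−β, β]. Let φⁿ be an array indexed by the grid indices with φⁿ_{i,j} = 0 at boundary indices and φⁿ_{i,j} ∈ [−β, β] at all indices. Then there exists a unique array φ^{n+1} with zero boundary entries satisfying the stabilized scheme at interior indices, namely (Ãφ^{n+1})_{i,j} = c̃·(φⁿ_{i,j} − (Δt̃/ε)·g(φⁿ_{i,j})) where Ã is the scaled 2D fourth-order scheme operator with time step Δt̃ (equivalently, (1 + SΔt)φ^{n+1} plus Δt times the fourth-order discrete convection-diffusion of φ^{n+1} equals φⁿ + SΔt·φⁿ − (Δt/ε)g(φⁿ) at interior indices), and every entry of φ^{n+1} lies in [−β, β]. -/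

import Mathlib

/-- The value of a grid array at a pair of natural indices (`0` outside the grid;
inside the grid all index arithmetic of the scheme stays in range). -/
noncomputable def gridVal (nx ny : ℕ) (φ : Fin (nx + 2) → Fin (ny + 2) → ℝ)
    (i j : ℕ) : ℝ :=
  if hi : i < nx + 2 then if hj : j < ny + 2 then φ ⟨i, hi⟩ ⟨j, hj⟩ else 0 else 0

/-- `(i,j)` is a boundary index of the `(nx+2) × (ny+2)` grid. -/
def isBdry (nx ny i j : ℕ) : Prop := i = 0 ∨ i = nx + 1 ∨ j = 0 ∨ j = ny + 1

instance (nx ny i j : ℕ) : Decidable (isBdry nx ny i j) := by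
  unfold isBdry; infer_instance

/-- The scaled 2D fourth-order scheme operator `A = (h²/(μΔt))·L̄` with `c = h²/(μΔt)`:
`(Aφ)ᵢⱼ = c·φᵢⱼ` at boundary indices; at interior indices the fourth-order finite
difference discretization of `c + (h²/μ)(u∂ₓ + v∂_y - μΔ)` obtained from the `Q²`
spectral element method, with the cell-center, x-edge-center, y-edge-center and knot
stencils depending on the parities of `i` and `j`. -/
noncomputable def schemeA2D (nx ny : ℕ) (h μ Δt : ℝ) (u v : ℕ → ℕ → ℝ)
    (φ : Fin (nx + 2) → Fin (ny + 2) → ℝ) (I : Fin (nx + 2)) (J : Fin (ny + 2)) : ℝ :=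
  let c := h ^ 2 / (μ * Δt)
  let i := (I : ℕ)
  let j := (J : ℕ)
  let ψ := gridVal nx ny φ
  if isBdry nx ny i j then c * φ I J
  else if Odd i ∧ Odd j then
    -- cell center
    c * ψ i j + h * u i j / (2 * μ) * (ψ (i + 1) j - ψ (i - 1) j)
      + h * v i j / (2 * μ) * (ψ i (j + 1) - ψ i (j - 1))
      + (-ψ (i - 1) j + 2 * ψ i j - ψ (i + 1) j)
      + (-ψ i (j - 1) + 2 * ψ i j - ψ i (j + 1))
  else if Odd i then
    -- x-edge center (edge parallel to the x-axis): `i` odd, `j` even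
    c * ψ i j + h * u i j / (2 * μ) * (ψ (i + 1) j - ψ (i - 1) j)
      + h * v i j / (4 * μ) * (ψ i (j - 2) - 4 * ψ i (j - 1) + 4 * ψ i (j + 1) - ψ i (j + 2))
      + (-ψ (i - 1) j + 2 * ψ i j - ψ (i + 1) j)
      + (ψ i (j - 2) - 8 * ψ i (j - 1) + 14 * ψ i j - 8 * ψ i (j + 1) + ψ i (j + 2)) / 4
  else if Odd j then
    -- y-edge center (edge parallel to the y-axis): `i` even, `j` odd
    c * ψ i j + h * u i j / (4 * μ) * (ψ (i - 2) j - 4 * ψ (i - 1) j + 4 * ψ (i + 1) j - ψ (i + 2) j)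
      + h * v i j / (2 * μ) * (ψ i (j + 1) - ψ i (j - 1))
      + (ψ (i - 2) j - 8 * ψ (i - 1) j + 14 * ψ i j - 8 * ψ (i + 1) j + ψ (i + 2) j) / 4
      + (-ψ i (j - 1) + 2 * ψ i j - ψ i (j + 1))
  else
    -- interior knot: `i` and `j` both even
    c * ψ i j + h * u i j / (4 * μ) * (ψ (i - 2) j - 4 * ψ (i - 1) j + 4 * ψ (i + 1) j - ψ (i + 2) j)
      + h * v i j / (4 * μ) * (ψ i (j - 2) - 4 * ψ i (j - 1) + 4 * ψ i (j + 1) - ψ i (j + 2))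
      + (ψ (i - 2) j - 8 * ψ (i - 1) j + 14 * ψ i j - 8 * ψ (i + 1) j + ψ (i + 2) j) / 4
      + (ψ i (j - 2) - 8 * ψ i (j - 1) + 14 * ψ i j - 8 * ψ i (j + 1) + ψ i (j + 2)) / 4

/-- The one-dimensional part of the scaled scheme at index `i`, with mesh Péclet number `P`. -/
noncomputable def dirStencil (P : ℝ) (f : ℕ → ℝ) (i : ℕ) : ℝ :=
  if Odd i then P / 2 * (f (i + 1) - f (i - 1)) + (-f (i - 1) + 2 * f i - f (i + 1))
  else P / 4 * (f (i - 2) - 4 * f (i - 1) + 4 * f (i + 1) - f (i + 2))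
    + (f (i - 2) - 8 * f (i - 1) + 14 * f i - 8 * f (i + 1) + f (i + 2)) / 4

theorem dirStencil_add (P : ℝ) (f g : ℕ → ℝ) (i : ℕ) :
    dirStencil P (fun k => f k + g k) i = dirStencil P f i + dirStencil P g i := by
  unfold dirStencil
  split_ifs <;> ring

theorem dirStencil_const_mul (P a : ℝ) (f : ℕ → ℝ) (i : ℕ) :
    dirStencil P (fun k => a * f k) i = a * dirStencil P f i := by
  unfold dirStencil
  split_ifs <;> ring

theorem dirStencil_eq_zero_of_const {n i : ℕ} (hn : Odd n) (hi : i ≤ n) {P t : ℝ} {f : ℕ → ℝ}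
    (hf : ∀ k ≤ n + 1, f k = t) : dirStencil P f i = 0 := by
  unfold dirStencil
  split_ifs with ho
  · rw [hf (i + 1) (by omega), hf (i - 1) (by omega), hf i (by omega)]
    ring
  · have : i + 2 ≤ n + 1 := by grind
    rw [hf (i - 2) (by omega), hf (i - 1) (by omega), hf i (by omega), hf (i + 1) (by omega),
      hf (i + 2) this]
    ring

theorem dirStencil_le_of_odd {P : ℝ} (hP : |P| ≤ 1 / 3) {f : ℕ → ℝ} (hf : ∀ k, 0 ≤ f k) {i : ℕ}
    (hi : Odd i) : dirStencil P f i ≤ 2 * f i - 5 / 6 * (f (i - 1) + f (i + 1)) := by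
  obtain ⟨h1, h2⟩ := abs_le.1 hP
  rw [dirStencil, if_pos hi]
  nlinarith [mul_nonneg (by linarith : 0 ≤ P + 1 / 3) (hf (i - 1)),
    mul_nonneg (by linarith : 0 ≤ 1 / 3 - P) (hf (i + 1))]

theorem dirStencil_le_of_not_odd {P : ℝ} (hP : |P| ≤ 1 / 3) {f : ℕ → ℝ} (hf : ∀ k, 0 ≤ f k) {i : ℕ}
    (hi : ¬ Odd i) (hl : f (i - 2) ≤ 7 * f (i - 1)) (hr : f (i + 2) ≤ 7 * f (i + 1)) :
    dirStencil P f i ≤ 7 / 2 * f i := by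
  obtain ⟨h1, h2⟩ := abs_le.1 hP
  rw [dirStencil, if_neg hi]
  nlinarith [mul_nonneg (by linarith : 0 ≤ 1 + P) (sub_nonneg.2 hl),
    mul_nonneg (by linarith : 0 ≤ 1 - P) (sub_nonneg.2 hr),
    mul_nonneg (by linarith : 0 ≤ 1 / 3 - P) (hf (i - 1)),
    mul_nonneg (by linarith : 0 ≤ P + 1 / 3) (hf (i + 1))]

/-- At an odd index, positivity of the operator controls both neighbours. -/
theorem neighbors_le_of_odd {P c Y : ℝ} (hP : |P| ≤ 1 / 3) (hc : c ≤ 1 / 3) {f : ℕ → ℝ}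
    (hf : ∀ k, 0 ≤ f k) {i : ℕ} (hi : Odd i) (hY : Y ≤ 7 / 2 * f i)
    (hpos : 0 < c * f i + dirStencil P f i + Y) :
    f (i - 1) ≤ 7 * f i ∧ f (i + 1) ≤ 7 * f i := by
  have h1 := dirStencil_le_of_odd hP hf hi
  have h2 := mul_le_mul_of_nonneg_right hc (hf i)
  constructor <;> linarith [hf (i - 1), hf (i + 1)]

theorem dirStencil_le {n : ℕ} (hn : Odd n) {P : ℝ} (hP : |P| ≤ 1 / 3) {f : ℕ → ℝ}
    (hf : ∀ k, 0 ≤ f k) {i : ℕ} (h1 : 1 ≤ i) (hi : i ≤ n)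
    (hnb : ¬ Odd i → ∀ k, Odd k → k ≤ n → f (k - 1) ≤ 7 * f k ∧ f (k + 1) ≤ 7 * f k) :
    dirStencil P f i ≤ 7 / 2 * f i := by
  by_cases ho : Odd i
  · linarith [dirStencil_le_of_odd hP hf ho, hf (i - 1), hf (i + 1), hf i]
  · refine dirStencil_le_of_not_odd hP hf ho ?_ ?_
    · exact (hnb ho (i - 1) (by grind) (by omega)).1
    · exact (hnb ho (i + 1) (by grind) (by grind)).2

/-- A nonnegative array at which the two-dimensional operator is positive in the interior is itself
positive in the interior. -/
theorem pos_of_dirStencil_pos {nx ny : ℕ} (hnx : Odd nx) (hny : Odd ny) {c : ℝ} (hc0 : 0 < c)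
    (hc : c ≤ 1 / 3) {P Q ψ : ℕ → ℕ → ℝ}
    (hP : ∀ i j, 1 ≤ i → i ≤ nx → 1 ≤ j → j ≤ ny → |P i j| ≤ 1 / 3)
    (hQ : ∀ i j, 1 ≤ i → i ≤ nx → 1 ≤ j → j ≤ ny → |Q i j| ≤ 1 / 3)
    (hψ : ∀ i j, 0 ≤ ψ i j)
    (hpos : ∀ i j, 1 ≤ i → i ≤ nx → 1 ≤ j → j ≤ ny →
      0 < c * ψ i j + dirStencil (P i j) (fun k => ψ k j) i + dirStencil (Q i j) (ψ i) j)
    {i j : ℕ} (hi : 1 ≤ i) (hin : i ≤ nx) (hj : 1 ≤ j) (hjn : j ≤ ny) : 0 < ψ i j := by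
  have hcenter_y : ∀ i j, Odd i → i ≤ nx → Odd j → j ≤ ny →
      ψ i (j - 1) ≤ 7 * ψ i j ∧ ψ i (j + 1) ≤ 7 * ψ i j := by
    intro i j oi hi oj hj
    have := hpos i j oi.pos hi oj.pos hj
    refine neighbors_le_of_odd (hQ i j oi.pos hi oj.pos hj) hc (hψ i) oj
      (dirStencil_le hnx (hP i j oi.pos hi oj.pos hj) (fun k => hψ k j) oi.pos hi
        (fun h => absurd oi h)) (by linarith)
  have hcenter_x : ∀ i j, Odd i → i ≤ nx → Odd j → j ≤ ny →
      ψ (i - 1) j ≤ 7 * ψ i j ∧ ψ (i + 1) j ≤ 7 * ψ i j := by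
    intro i j oi hi oj hj
    exact neighbors_le_of_odd (hP i j oi.pos hi oj.pos hj) hc (fun k => hψ k j) oi
      (dirStencil_le hny (hQ i j oi.pos hi oj.pos hj) (hψ i) oj.pos hj
        (fun h => absurd oj h)) (hpos i j oi.pos hi oj.pos hj)
  have hnb_x : ∀ i j, Odd i → i ≤ nx → 1 ≤ j → j ≤ ny →
      ψ (i - 1) j ≤ 7 * ψ i j ∧ ψ (i + 1) j ≤ 7 * ψ i j := by
    intro i j oi hi hj hjn
    exact neighbors_le_of_odd (hP i j oi.pos hi hj hjn) hc (fun k => hψ k j) oi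
      (dirStencil_le hny (hQ i j oi.pos hi hj hjn) (hψ i) hj hjn
        (fun _ k ok hk => hcenter_y i k oi hi ok hk)) (hpos i j oi.pos hi hj hjn)
  have hnb_y : ∀ i j, 1 ≤ i → i ≤ nx → Odd j → j ≤ ny →
      ψ i (j - 1) ≤ 7 * ψ i j ∧ ψ i (j + 1) ≤ 7 * ψ i j := by
    intro i j hi hin oj hj
    have := hpos i j hi hin oj.pos hj
    exact neighbors_le_of_odd (hQ i j hi hin oj.pos hj) hc (hψ i) oj
      (dirStencil_le hnx (hP i j hi hin oj.pos hj) (fun k => hψ k j) hi hin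
        (fun _ k ok hk => hcenter_x k j ok hk oj hj)) (by linarith)
  have hx := dirStencil_le hnx (hP i j hi hin hj hjn) (fun k => hψ k j) hi hin
    (fun _ k ok hk => hnb_x k j ok hk hj hjn)
  have hy := dirStencil_le hny (hQ i j hi hin hj hjn) (hψ i) hj hjn
    (fun _ k ok hk => hnb_y i k hi hin ok hk)
  have := hpos i j hi hin hj hjn
  exact pos_of_mul_pos_right (a := c + 7) (by linarith) (by linarith)

theorem gridVal_coe {nx ny : ℕ} (φ : Fin (nx + 2) → Fin (ny + 2) → ℝ) (I : Fin (nx + 2))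
    (J : Fin (ny + 2)) : gridVal nx ny φ I J = φ I J := by
  simp [gridVal]

theorem gridVal_nonneg {nx ny : ℕ} {φ : Fin (nx + 2) → Fin (ny + 2) → ℝ} (hφ : ∀ I J, 0 ≤ φ I J)
    (i j : ℕ) : 0 ≤ gridVal nx ny φ i j := by
  unfold gridVal
  split_ifs <;> simp [hφ]

theorem gridVal_add {nx ny : ℕ} (φ ψ : Fin (nx + 2) → Fin (ny + 2) → ℝ) (i j : ℕ) :
    gridVal nx ny (φ + ψ) i j = gridVal nx ny φ i j + gridVal nx ny ψ i j := by
  unfold gridVal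
  split_ifs <;> simp

theorem gridVal_smul {nx ny : ℕ} (a : ℝ) (φ : Fin (nx + 2) → Fin (ny + 2) → ℝ) (i j : ℕ) :
    gridVal nx ny (a • φ) i j = a * gridVal nx ny φ i j := by
  unfold gridVal
  split_ifs <;> simp

theorem gridVal_const {nx ny : ℕ} (t : ℝ) {i j : ℕ} (hi : i ≤ nx + 1) (hj : j ≤ ny + 1) :
    gridVal nx ny (fun _ _ => t) i j = t := by
  simp [gridVal, Nat.lt_succ_of_le hi, Nat.lt_succ_of_le hj]

theorem schemeA2D_of_isBdry {nx ny : ℕ} (h μ τ : ℝ) (u v : ℕ → ℕ → ℝ)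
    (φ : Fin (nx + 2) → Fin (ny + 2) → ℝ) {I : Fin (nx + 2)} {J : Fin (ny + 2)}
    (hb : isBdry nx ny I J) : schemeA2D nx ny h μ τ u v φ I J = h ^ 2 / (μ * τ) * φ I J :=
  if_pos hb

theorem schemeA2D_of_not_isBdry {nx ny : ℕ} (h μ τ : ℝ) (u v : ℕ → ℕ → ℝ)
    (φ : Fin (nx + 2) → Fin (ny + 2) → ℝ) {I : Fin (nx + 2)} {J : Fin (ny + 2)}
    (hb : ¬ isBdry nx ny I J) :
    schemeA2D nx ny h μ τ u v φ I J = h ^ 2 / (μ * τ) * gridVal nx ny φ I J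
      + dirStencil (h * u I J / μ) (fun k => gridVal nx ny φ k J) I
      + dirStencil (h * v I J / μ) (gridVal nx ny φ I) J := by
  have h2 (x : ℝ) : x / (2 * μ) = x / μ / 2 := by rw [div_div, mul_comm]
  have h4 (x : ℝ) : x / (4 * μ) = x / μ / 4 := by rw [div_div, mul_comm]
  simp only [schemeA2D, if_neg hb, dirStencil, h2, h4]
  by_cases hI : Odd (I : ℕ) <;> by_cases hJ : Odd (J : ℕ) <;> simp only [hI, hJ, and_self, and_true,
    and_false, if_true, if_false] <;> ring

/-- The scaled scheme operator as a linear map. -/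
noncomputable def schemeLinearMap (nx ny : ℕ) (h μ τ : ℝ) (u v : ℕ → ℕ → ℝ) :
    (Fin (nx + 2) → Fin (ny + 2) → ℝ) →ₗ[ℝ] (Fin (nx + 2) → Fin (ny + 2) → ℝ) where
  toFun := schemeA2D nx ny h μ τ u v
  map_add' φ ψ := by
    ext I J
    by_cases hb : isBdry nx ny I J
    · simp only [Pi.add_apply, schemeA2D_of_isBdry _ _ _ _ _ _ hb]
      ring
    · simp only [Pi.add_apply, schemeA2D_of_not_isBdry _ _ _ _ _ _ hb, gridVal_add,
        funext (gridVal_add φ ψ I), dirStencil_add]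
      ring
  map_smul' a φ := by
    ext I J
    by_cases hb : isBdry nx ny I J
    · simp only [Pi.smul_apply, schemeA2D_of_isBdry _ _ _ _ _ _ hb, smul_eq_mul, RingHom.id_apply]
      ring
    · simp only [Pi.smul_apply, schemeA2D_of_not_isBdry _ _ _ _ _ _ hb, gridVal_smul,
        funext (gridVal_smul a φ I), dirStencil_const_mul, smul_eq_mul, RingHom.id_apply]
      ring

theorem schemeLinearMap_apply {nx ny : ℕ} (h μ τ : ℝ) (u v : ℕ → ℕ → ℝ)
    (φ : Fin (nx + 2) → Fin (ny + 2) → ℝ) :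
    schemeLinearMap nx ny h μ τ u v φ = schemeA2D nx ny h μ τ u v φ := rfl

theorem schemeLinearMap_const {nx ny : ℕ} (hnx : Odd nx) (hny : Odd ny) (h μ τ : ℝ)
    (u v : ℕ → ℕ → ℝ) (t : ℝ) :
    schemeLinearMap nx ny h μ τ u v (fun _ _ => t) = fun _ _ => h ^ 2 / (μ * τ) * t := by
  ext I J
  rw [schemeLinearMap_apply]
  by_cases hb : isBdry nx ny I J
  · exact schemeA2D_of_isBdry _ _ _ _ _ _ hb
  · have hI : (I : ℕ) ≤ nx := by have := I.2; unfold isBdry at hb; omega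
    have hJ : (J : ℕ) ≤ ny := by have := J.2; unfold isBdry at hb; omega
    rw [schemeA2D_of_not_isBdry _ _ _ _ _ _ hb, gridVal_const t (by omega) (by omega),
      dirStencil_eq_zero_of_const hnx hI (fun k hk => gridVal_const t hk (by omega)),
      dirStencil_eq_zero_of_const hny hJ (fun k hk => gridVal_const t (by omega) hk)]
    ring

/-- Discrete monotonicity of the scheme operator under the mesh constraints. -/
theorem nonneg_of_schemeLinearMap_nonneg {nx ny : ℕ} (hnx : Odd nx) (hny : Odd ny) {h μ τ : ℝ}
    {u v : ℕ → ℕ → ℝ} (hc0 : 0 < h ^ 2 / (μ * τ)) (hc : h ^ 2 / (μ * τ) ≤ 1 / 3)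
    (hu : ∀ i j, 1 ≤ i → i ≤ nx → 1 ≤ j → j ≤ ny → |h * u i j / μ| ≤ 1 / 3)
    (hv : ∀ i j, 1 ≤ i → i ≤ nx → 1 ≤ j → j ≤ ny → |h * v i j / μ| ≤ 1 / 3)
    {φ : Fin (nx + 2) → Fin (ny + 2) → ℝ}
    (hφ : ∀ I J, 0 ≤ schemeLinearMap nx ny h μ τ u v φ I J) (I : Fin (nx + 2))
    (J : Fin (ny + 2)) : 0 ≤ φ I J := by
  obtain ⟨⟨I₀, J₀⟩, hmin⟩ := Finite.exists_min (fun p : Fin (nx + 2) × Fin (ny + 2) => φ p.1 p.2)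
  by_contra! hneg
  have ht : φ I₀ J₀ < 0 := (hmin (I, J)).trans_lt hneg
  set ψ : Fin (nx + 2) → Fin (ny + 2) → ℝ := φ + fun _ _ => -φ I₀ J₀ with hψ
  have hψ0 : ψ I₀ J₀ = 0 := by simp [hψ]
  have hψn : ∀ I J, 0 ≤ ψ I J := fun I J => by
    have := hmin (I, J)
    simp only [hψ, Pi.add_apply]
    linarith
  have hψA : ∀ I J, 0 < schemeA2D nx ny h μ τ u v ψ I J := fun I J => by
    rw [← schemeLinearMap_apply, hψ, map_add, schemeLinearMap_const hnx hny]
    exact add_pos_of_nonneg_of_pos (hφ I J) (mul_pos hc0 (neg_pos.2 ht))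
  by_cases hb : isBdry nx ny I₀ J₀
  · have := hψA I₀ J₀
    rw [schemeA2D_of_isBdry _ _ _ _ _ _ hb, hψ0, mul_zero] at this
    exact this.false
  · have hpos : 0 < gridVal nx ny ψ I₀ J₀ := by
      have := I₀.2
      have := J₀.2
      refine pos_of_dirStencil_pos hnx hny hc0 hc hu hv (gridVal_nonneg hψn) ?_
        (by unfold isBdry at hb; omega) (by unfold isBdry at hb; omega)
        (by unfold isBdry at hb; omega) (by unfold isBdry at hb; omega)
      intro i j hi hin hj hjn
      have hij : ¬ isBdry nx ny i j := by unfold isBdry; omega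
      have := hψA ⟨i, by omega⟩ ⟨j, by omega⟩
      rwa [schemeA2D_of_not_isBdry _ _ _ _ _ _ hij] at this
    rw [gridVal_coe, hψ0] at hpos
    exact hpos.false

theorem schemeLinearMap_bijective {nx ny : ℕ} (hnx : Odd nx) (hny : Odd ny) {h μ τ : ℝ}
    {u v : ℕ → ℕ → ℝ} (hc0 : 0 < h ^ 2 / (μ * τ)) (hc : h ^ 2 / (μ * τ) ≤ 1 / 3)
    (hu : ∀ i j, 1 ≤ i → i ≤ nx → 1 ≤ j → j ≤ ny → |h * u i j / μ| ≤ 1 / 3)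
    (hv : ∀ i j, 1 ≤ i → i ≤ nx → 1 ≤ j → j ≤ ny → |h * v i j / μ| ≤ 1 / 3) :
    Function.Bijective (schemeLinearMap nx ny h μ τ u v) := by
  have hinj : Function.Injective (schemeLinearMap nx ny h μ τ u v) := by
    rw [injective_iff_map_eq_zero]
    intro φ hφ
    ext I J
    refine le_antisymm ?_
      (nonneg_of_schemeLinearMap_nonneg hnx hny hc0 hc hu hv (φ := φ) (by simp [hφ]) I J)
    have := nonneg_of_schemeLinearMap_nonneg hnx hny hc0 hc hu hv (φ := -φ) (by simp [hφ]) I J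
    simpa using this
  exact ⟨hinj, LinearMap.injective_iff_surjective.1 hinj⟩

/-- The bounds of a solution follow from the same bounds, scaled, on the right-hand side. -/
theorem mem_Icc_of_schemeLinearMap_mem_Icc {nx ny : ℕ} (hnx : Odd nx) (hny : Odd ny) {h μ τ : ℝ}
    {u v : ℕ → ℕ → ℝ} (hc0 : 0 < h ^ 2 / (μ * τ)) (hc : h ^ 2 / (μ * τ) ≤ 1 / 3)
    (hu : ∀ i j, 1 ≤ i → i ≤ nx → 1 ≤ j → j ≤ ny → |h * u i j / μ| ≤ 1 / 3)
    (hv : ∀ i j, 1 ≤ i → i ≤ nx → 1 ≤ j → j ≤ ny → |h * v i j / μ| ≤ 1 / 3)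
    {φ : Fin (nx + 2) → Fin (ny + 2) → ℝ} {a b : ℝ}
    (hφ : ∀ I J, schemeLinearMap nx ny h μ τ u v φ I J ∈
      Set.Icc (h ^ 2 / (μ * τ) * a) (h ^ 2 / (μ * τ) * b)) (I : Fin (nx + 2))
    (J : Fin (ny + 2)) : φ I J ∈ Set.Icc a b := by
  have hlow := nonneg_of_schemeLinearMap_nonneg hnx hny hc0 hc hu hv (φ := φ - fun _ _ => a)
    (fun I J => by
      rw [map_sub, schemeLinearMap_const hnx hny]
      exact sub_nonneg.2 (hφ I J).1) I J
  have hupp := nonneg_of_schemeLinearMap_nonneg hnx hny hc0 hc hu hv (φ := (fun _ _ => b) - φ)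
    (fun I J => by
      rw [map_sub, schemeLinearMap_const hnx hny]
      exact sub_nonneg.2 (hφ I J).2) I J
  exact ⟨sub_nonneg.1 hlow, sub_nonneg.1 hupp⟩

/-- The explicit reaction step preserves `[-β, β]`. -/
theorem sub_mul_mem_Icc {β ε τ : ℝ} (hε : 0 < ε) {g : ℝ → ℝ}
    (hdiff : DifferentiableOn ℝ g (Set.Icc (-β) β)) (hgm : g (-β) = 0) (hgp : g β = 0)
    (hderiv : ∀ x ∈ Set.Icc (-β) β, τ * derivWithin g (Set.Icc (-β) β) x ≤ ε) {x : ℝ}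
    (hx : x ∈ Set.Icc (-β) β) : x - τ / ε * g x ∈ Set.Icc (-β) β := by
  have hβ : -β ≤ β := hx.1.trans hx.2
  have hmono : MonotoneOn (fun x => x - τ / ε * g x) (Set.Icc (-β) β) := by
    refine monotoneOn_of_hasDerivWithinAt_nonneg (convex_Icc _ _)
      (f' := fun x => 1 - τ / ε * derivWithin g (Set.Icc (-β) β) x)
      (continuousOn_id.sub (hdiff.continuousOn.const_mul _)) ?_ ?_
    · intro y hy
      exact (hasDerivWithinAt_id y _).sub
        (((hdiff y (interior_subset hy)).hasDerivWithinAt.mono interior_subset).const_mul _)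
    · intro y hy
      rw [sub_nonneg, div_mul_eq_mul_div, div_le_one hε]
      exact hderiv y (interior_subset hy)
  have h1 := hmono (Set.left_mem_Icc.2 hβ) hx hx.1
  have h2 := hmono hx (Set.right_mem_Icc.2 hβ) hx.2
  simp only [hgm, hgp, mul_zero, sub_zero] at h1 h2
  exact ⟨h1, h2⟩

/-- Theorem 4.3 in the paper (bound preservation of the stabilized IMEX fourth-order
scheme, stabilization parameter `S ≥ 0`, for the generalized Allen-Cahn equation with
homogeneous Dirichlet boundary condition): with the effective time step
`Δt' = Δt/(1 + Δt·S)` and `c' = h²/(μΔt')`, under the convenient mesh constraints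
`h·‖(u,v)‖_∞/μ ≤ 1/3`, `Δt'·μ/h² ≥ 3` and the constraint `Δt'·F'' ≤ ε` on `[-β, β]`:
if `φⁿ` vanishes on the boundary and has all entries in `[-β, β]`, then the stabilized
IMEX step `(A'φⁿ⁺¹)ᵢⱼ = c'·(φⁿᵢⱼ - (Δt'/ε)·g(φⁿᵢⱼ))` at interior indices (where `A'` is
the scaled scheme operator with time step `Δt'`), `φⁿ⁺¹ = 0` on the boundary, has a
unique solution `φⁿ⁺¹`, and all its entries lie in `[-β, β]`. -/
theorem allenCahn_stabilized_imex_bound_preserving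
    (nx ny : ℕ) (hnx : Odd nx) (hny : Odd ny) (hnx3 : 3 ≤ nx) (hny3 : 3 ≤ ny)
    (h μ Δt S : ℝ) (hh : 0 < h) (hμ : 0 < μ) (hΔt : 0 < Δt) (hS : 0 ≤ S)
    (Δt' : ℝ) (hΔt' : Δt' = Δt / (1 + Δt * S))
    (u v : ℕ → ℕ → ℝ) (m : ℝ)
    (hm : IsGreatest {x : ℝ | ∃ i j : ℕ, 1 ≤ i ∧ i ≤ nx ∧ 1 ≤ j ∧ j ≤ ny ∧
      x = max |u i j| |v i j|} m)
    (hmesh : h * m / μ ≤ 1 / 3)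
    (hstep : Δt' * μ / h ^ 2 ≥ 3)
    (β ε : ℝ) (hβ : 0 < β) (hε : 0 < ε)
    (g : ℝ → ℝ)
    (hdiff : DifferentiableOn ℝ g (Set.Icc (-β) β))
    (hgm : g (-β) = 0) (hgp : g β = 0)
    (hderiv : ∀ x ∈ Set.Icc (-β) β, Δt' * derivWithin g (Set.Icc (-β) β) x ≤ ε)
    (φn : Fin (nx + 2) → Fin (ny + 2) → ℝ)
    (hφnBdry : ∀ (I : Fin (nx + 2)) (J : Fin (ny + 2)),
      isBdry nx ny (I : ℕ) (J : ℕ) → φn I J = 0)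
    (hφnBound : ∀ I J, φn I J ∈ Set.Icc (-β) β) :
    (∃! φ' : Fin (nx + 2) → Fin (ny + 2) → ℝ,
        (∀ (I : Fin (nx + 2)) (J : Fin (ny + 2)),
          isBdry nx ny (I : ℕ) (J : ℕ) → φ' I J = 0) ∧
        ∀ (I : Fin (nx + 2)) (J : Fin (ny + 2)), ¬ isBdry nx ny (I : ℕ) (J : ℕ) →
          schemeA2D nx ny h μ Δt' u v φ' I J
            = h ^ 2 / (μ * Δt') * (φn I J - Δt' / ε * g (φn I J))) ∧
      ∀ φ' : Fin (nx + 2) → Fin (ny + 2) → ℝ,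
        ((∀ (I : Fin (nx + 2)) (J : Fin (ny + 2)),
            isBdry nx ny (I : ℕ) (J : ℕ) → φ' I J = 0) ∧
          ∀ (I : Fin (nx + 2)) (J : Fin (ny + 2)), ¬ isBdry nx ny (I : ℕ) (J : ℕ) →
            schemeA2D nx ny h μ Δt' u v φ' I J
              = h ^ 2 / (μ * Δt') * (φn I J - Δt' / ε * g (φn I J))) →
        ∀ I J, φ' I J ∈ Set.Icc (-β) β := by
  have hτ : 0 < Δt' := by rw [hΔt']; positivity
  have hc0 : 0 < h ^ 2 / (μ * Δt') := by positivity
  have hc : h ^ 2 / (μ * Δt') ≤ 1 / 3 := by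
    rw [ge_iff_le, le_div_iff₀ (by positivity)] at hstep
    rw [div_le_iff₀ (by positivity)]
    linarith
  have hpeclet : ∀ w : ℝ, |w| ≤ m → |h * w / μ| ≤ 1 / 3 := fun w hw => by
    rw [abs_div, abs_mul, abs_of_pos hh, abs_of_pos hμ]
    exact le_trans (by gcongr) hmesh
  have hu : ∀ i j, 1 ≤ i → i ≤ nx → 1 ≤ j → j ≤ ny → |h * u i j / μ| ≤ 1 / 3 :=
    fun i j h1 h2 h3 h4 => hpeclet _
      ((le_max_left _ _).trans (hm.2 ⟨i, j, h1, h2, h3, h4, rfl⟩))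
  have hv : ∀ i j, 1 ≤ i → i ≤ nx → 1 ≤ j → j ≤ ny → |h * v i j / μ| ≤ 1 / 3 :=
    fun i j h1 h2 h3 h4 => hpeclet _
      ((le_max_right _ _).trans (hm.2 ⟨i, j, h1, h2, h3, h4, rfl⟩))
  set rhs : Fin (nx + 2) → Fin (ny + 2) → ℝ := fun I J =>
    if isBdry nx ny I J then 0 else h ^ 2 / (μ * Δt') * (φn I J - Δt' / ε * g (φn I J)) with hrhs
  have hiff : ∀ φ' : Fin (nx + 2) → Fin (ny + 2) → ℝ,
      ((∀ (I : Fin (nx + 2)) (J : Fin (ny + 2)),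
          isBdry nx ny (I : ℕ) (J : ℕ) → φ' I J = 0) ∧
        ∀ (I : Fin (nx + 2)) (J : Fin (ny + 2)), ¬ isBdry nx ny (I : ℕ) (J : ℕ) →
          schemeA2D nx ny h μ Δt' u v φ' I J
            = h ^ 2 / (μ * Δt') * (φn I J - Δt' / ε * g (φn I J))) ↔
      schemeLinearMap nx ny h μ Δt' u v φ' = rhs := by
    intro φ'
    rw [schemeLinearMap_apply]
    constructor
    · rintro ⟨h0, h1⟩
      ext I J
      by_cases hb : isBdry nx ny I J
      · rw [schemeA2D_of_isBdry _ _ _ _ _ _ hb, h0 I J hb, mul_zero, hrhs]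
        exact (if_pos hb).symm
      · rw [h1 I J hb, hrhs]
        exact (if_neg hb).symm
    · intro heq
      refine ⟨fun I J hb => ?_, fun I J hb => ?_⟩
      · have := congrFun (congrFun heq I) J
        rw [schemeA2D_of_isBdry _ _ _ _ _ _ hb] at this
        simpa [hrhs, hb, hc0.ne'] using this
      · rw [heq]
        exact if_neg hb
  simp only [hiff]
  refine ⟨(schemeLinearMap_bijective hnx hny hc0 hc hu hv).existsUnique rhs, fun φ' hφ' =>
    mem_Icc_of_schemeLinearMap_mem_Icc hnx hny hc0 hc hu hv fun I J => ?_⟩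
  rw [hφ']
  by_cases hb : isBdry nx ny I J
  · have : rhs I J = 0 := if_pos hb
    rw [this]
    constructor <;> nlinarith [mul_pos hc0 hβ]
  · have : rhs I J = h ^ 2 / (μ * Δt') * (φn I J - Δt' / ε * g (φn I J)) := if_neg hb
    obtain ⟨h1, h2⟩ := sub_mul_mem_Icc hε hdiff hgm hgp hderiv (hφnBound I J)
    rw [this]
    exact ⟨mul_le_mul_of_nonneg_left h1 hc0.le, mul_le_mul_of_nonneg_left h2 hc0.le⟩
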